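/- Let m ≥ 1 and let φ : ℝ^m → ℝ be a homogeneous polynomial function of degree k ≥ 1 (i.e., φ is given by a polynomial and φ(t·x) = t^k φ(x) for all t ∈ ℝ, x ∈ ℝ^m). Then there exists a Lebesgue-measurable set E ⊆ ℝ^m such that: (1) for all integers j ≠ j', the set 2^j E ∩ 2^{j'} E has Lebesgue measure zero; (2) ℝ^m \ ⋃_{j∈ℤ} 2^j E has Lebesgue measure zero; and (3) E ⊆ φ^{-1}([-1, 1]). -/

import Mathlib

open MeasureTheory
open scoped Pointwise

/-- Membership in a dyadic dilate of the annulus `{x | ‖x‖ / c ∈ (1, 2]}`. -/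
theorem mem_two_zpow_smul_annulus {V : Type*} [NormedAddCommGroup V] [NormedSpace ℝ V]
    (c : ℝ) (j : ℤ) (x : V) :
    x ∈ ((2 : ℝ) ^ j) • {y : V | ‖y‖ / c ∈ Set.Ioc (1 : ℝ) 2} ↔
      ‖x‖ / c ∈ Set.Ioc ((2 : ℝ) ^ j) ((2 : ℝ) ^ (j + 1)) := by
  have h2 : (0 : ℝ) < 2 ^ j := by positivity
  have key : ‖((2 : ℝ) ^ j)⁻¹ • x‖ / c = (‖x‖ / c) / 2 ^ j := by
    rw [norm_smul, norm_inv, Real.norm_of_nonneg h2.le]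
    ring
  rw [Set.mem_smul_set_iff_inv_smul_mem₀ h2.ne', Set.mem_ofPred_eq, key, Set.mem_Ioc,
    Set.mem_Ioc, lt_div_iff₀ h2, div_le_iff₀ h2, zpow_add_one₀ two_ne_zero, one_mul, mul_comm 2]

/-- Let `φ : ℝ^m → ℝ` be a homogeneous polynomial function of degree `k ≥ 1`.  Then there
is a measurable set `E ⊆ ℝ^m` whose dyadic dilates `2^j E`, `j ∈ ℤ`, have pairwise null
intersections and cover `ℝ^m` up to a null set, and with `E ⊆ φ⁻¹([-1, 1])`. -/
theorem stmt4 (m : ℕ) (hm : 1 ≤ m) (φ : (Fin m → ℝ) → ℝ)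
    (hpoly : ∃ P : MvPolynomial (Fin m) ℝ, ∀ x, φ x = MvPolynomial.eval x P)
    (k : ℕ) (hk : 1 ≤ k)
    (hhom : ∀ (t : ℝ) (x : Fin m → ℝ), φ (t • x) = t ^ k * φ x) :
    ∃ E : Set (Fin m → ℝ), MeasurableSet E ∧
      (∀ j j' : ℤ, j ≠ j' →
        volume ((((2 : ℝ) ^ j) • E) ∩ (((2 : ℝ) ^ j') • E)) = 0) ∧
      volume ((⋃ j : ℤ, ((2 : ℝ) ^ j) • E)ᶜ) = 0 ∧
      E ⊆ φ ⁻¹' Set.Icc (-1 : ℝ) 1 := by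
  obtain ⟨P, hP⟩ := hpoly
  have hcont : Continuous φ := by
    rw [funext hP]
    exact MvPolynomial.continuous_eval P
  have hzero : φ 0 = 0 := by
    simpa [Nat.ne_of_gt hk] using hhom 0 0
  obtain ⟨δ, hδ, hball⟩ := Metric.continuousAt_iff.mp (hcont.continuousAt (x := 0)) 1 one_pos
  have hc : 0 < δ / 4 := by positivity
  refine ⟨{x | ‖x‖ / (δ / 4) ∈ Set.Ioc (1 : ℝ) 2}, ?_, ?_, ?_, ?_⟩
  · exact (measurable_norm.div_const _) measurableSet_Ioc
  · intro j j' hjj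
    convert measure_empty (μ := (volume : Measure (Fin m → ℝ)))
    refine Set.eq_empty_of_forall_notMem fun x hx => hjj ?_
    obtain ⟨hx1, hx2⟩ := hx
    rw [mem_two_zpow_smul_annulus] at hx1 hx2
    have h1 := (zpow_lt_zpow_iff_right₀ (one_lt_two : (1 : ℝ) < 2)).mp (hx1.1.trans_le hx2.2)
    have h2 := (zpow_lt_zpow_iff_right₀ (one_lt_two : (1 : ℝ) < 2)).mp (hx2.1.trans_le hx1.2)
    omega
  · have : Nonempty (Fin m) := ⟨⟨0, hm⟩⟩
    refine measure_mono_null (t := {0}) (fun x hx => ?_) (measure_singleton _)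
    by_contra hx0
    obtain ⟨j, hj⟩ := exists_mem_Ioc_zpow (div_pos (norm_pos_iff.mpr hx0) hc)
      (one_lt_two : (1 : ℝ) < 2)
    exact hx (Set.mem_iUnion.mpr ⟨j, (mem_two_zpow_smul_annulus _ _ _).mpr hj⟩)
  · intro x hx
    have hle : ‖x‖ ≤ 2 * (δ / 4) := (div_le_iff₀ hc).mp hx.2
    have h := hball (x := x) (by rw [dist_zero_right]; linarith)
    rw [hzero, dist_zero_right, Real.norm_eq_abs] at h
    exact abs_le.mp h.le
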